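/- Let g ∈ C(S¹) with ∫_{S¹} g dθ = 0. Then there exists a unique function w, harmonic on the exterior domain ℝ² \ closed unit ball, continuous up to the boundary with w = g on the unit circle, and satisfying |w(x)| ≤ C |x|^{-1} sup|g| for |x| ≥ 1, for some constant C independent of g. -/

import Mathlib

open Set Filter Topology MeasureTheory

lemma no_max_of_pos (f : ℝ → ℝ) (x : ℝ) (hf : ContinuousAt f x) (hm : IsLocalMax f x)
    (hp : 0 < deriv (deriv f) x) : False := by
  have h1 := isLocalMin_of_deriv_deriv_pos hp hm.deriv_eq_zero hf
  have h2 : f =ᶠ[𝓝 x] fun _ => f x := by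
    filter_upwards [h1, hm] with y a b using le_antisymm b a
  have h3 : deriv (deriv f) x = 0 := by
    rw [h2.deriv.deriv_eq]; simp
  linarith

lemma dd_comb (f g : ℝ → ℝ) (d c x : ℝ) (hf : ContDiffAt ℝ 2 f x) (hg : ContDiffAt ℝ 2 g x) :
    deriv (deriv (fun t => f t - g t + d * (t ^ 2 + c))) x =
      deriv (deriv f) x - deriv (deriv g) x + 2 * d := by
  have key : ∀ h : ℝ → ℝ, ContDiffAt ℝ 2 h x → (∀ᶠ t in 𝓝 x, DifferentiableAt ℝ h t) ∧
      DifferentiableAt ℝ (deriv h) x := by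
    intro h hh
    constructor
    · filter_upwards [hh.eventually (by simp)] with t ht
      exact ht.differentiableAt (by simp)
    · have h2 : ContDiffAt ℝ 1 (deriv h) x := by
        have h3 := ContDiffAt.fderiv_right (m := 1) hh (by norm_num)
        have h4 : deriv h = fun t => fderiv ℝ h t 1 := by funext t; simp
        rw [h4]
        exact h3.clm_apply contDiffAt_const
      exact h2.differentiableAt (by simp)
  obtain ⟨f1, f2⟩ := key f hf
  obtain ⟨g1, g2⟩ := key g hg
  have e : deriv (fun t => f t - g t + d * (t ^ 2 + c)) =ᶠ[𝓝 x]
      fun t => deriv f t - deriv g t + d * (2 * t) := by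
    filter_upwards [f1, g1] with t a b
    have := (a.hasDerivAt.sub b.hasDerivAt).add ((((hasDerivAt_id t).pow 2).add_const c).const_mul d)
    refine HasDerivAt.deriv (this.congr_deriv ?_)
    simp
  rw [e.deriv_eq]
  have := (f2.hasDerivAt.sub g2.hasDerivAt).add (((hasDerivAt_id x).const_mul 2).const_mul d)
  refine HasDerivAt.deriv (this.congr_deriv ?_)
  ring

lemma ext_cmp (w₁ w₂ : ℝ → ℝ → ℝ) (K : ℝ)
    (c1 : ContinuousOn (Function.uncurry w₁) {p : ℝ × ℝ | 1 ≤ p.1 ^ 2 + p.2 ^ 2})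
    (c2 : ContinuousOn (Function.uncurry w₂) {p : ℝ × ℝ | 1 ≤ p.1 ^ 2 + p.2 ^ 2})
    (d1 : ContDiffOn ℝ 2 (Function.uncurry w₁) {p : ℝ × ℝ | 1 < p.1 ^ 2 + p.2 ^ 2})
    (d2 : ContDiffOn ℝ 2 (Function.uncurry w₂) {p : ℝ × ℝ | 1 < p.1 ^ 2 + p.2 ^ 2})
    (l1 : ∀ x y : ℝ, 1 < x ^ 2 + y ^ 2 →
      deriv (deriv (fun x' => w₁ x' y)) x + deriv (deriv (fun y' => w₁ x y')) y = 0)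
    (l2 : ∀ x y : ℝ, 1 < x ^ 2 + y ^ 2 →
      deriv (deriv (fun x' => w₂ x' y)) x + deriv (deriv (fun y' => w₂ x y')) y = 0)
    (hb : ∀ x y : ℝ, x ^ 2 + y ^ 2 = 1 → w₁ x y = w₂ x y)
    (k1 : ∀ x y : ℝ, 1 ≤ x ^ 2 + y ^ 2 → |w₁ x y| ≤ K * (Real.sqrt (x ^ 2 + y ^ 2))⁻¹)
    (k2 : ∀ x y : ℝ, 1 ≤ x ^ 2 + y ^ 2 → |w₂ x y| ≤ K * (Real.sqrt (x ^ 2 + y ^ 2))⁻¹)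
    (x y : ℝ) (hxy : 1 ≤ x ^ 2 + y ^ 2) : w₁ x y ≤ w₂ x y := by
  by_contra! hlt
  set d := w₁ x y - w₂ x y with hd
  have hdpos : 0 < d := by linarith
  have hK : 0 ≤ K := by
    have := (abs_nonneg _).trans (k1 1 0 (by norm_num))
    simpa using this
  set r := Real.sqrt (x ^ 2 + y ^ 2) with hr
  have hr1 : 1 ≤ r := Real.one_le_sqrt.2 hxy
  set R := r + 4 * K / d + 1 with hR
  have hq : 0 ≤ 4 * K / d := by positivity
  have hRpos : 0 < R := by linarith
  have hRK : 4 * K < d * R := by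
    have : d * (4 * K / d) = 4 * K := by field_simp
    nlinarith
  have hrR : x ^ 2 + y ^ 2 ≤ R ^ 2 := by
    have : r ^ 2 = x ^ 2 + y ^ 2 := Real.sq_sqrt (by positivity)
    nlinarith
  set δ := d / (2 * R ^ 2) with hδ
  have hδpos : 0 < δ := by positivity
  have hδR : δ * R ^ 2 = d / 2 := by rw [hδ]; field_simp
  let S : Set (ℝ × ℝ) := {p | 1 ≤ p.1 ^ 2 + p.2 ^ 2 ∧ p.1 ^ 2 + p.2 ^ 2 ≤ R ^ 2}
  have hn : Continuous fun p : ℝ × ℝ => p.1 ^ 2 + p.2 ^ 2 := by fun_prop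
  have hScl : IsClosed S := by
    have := (isClosed_le (continuous_const (y := (1 : ℝ))) hn).inter (isClosed_le hn (continuous_const (y := R ^ 2)))
    exact this
  have hScomp : IsCompact S := by
    refine IsCompact.of_isClosed_subset (isCompact_Icc (a := ((-R, -R) : ℝ × ℝ)) (b := (R, R))) hScl ?_
    rintro ⟨a, b⟩ ⟨-, h⟩
    have ha := abs_le_of_sq_le_sq' (show a ^ 2 ≤ R ^ 2 by simp at h; nlinarith [sq_nonneg b]) hRpos.le
    have hb := abs_le_of_sq_le_sq' (show b ^ 2 ≤ R ^ 2 by simp at h; nlinarith [sq_nonneg a]) hRpos.le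
    exact ⟨⟨ha.1, hb.1⟩, ⟨ha.2, hb.2⟩⟩
  let φ : ℝ × ℝ → ℝ := fun p => w₁ p.1 p.2 - w₂ p.1 p.2 + δ * (p.1 ^ 2 + p.2 ^ 2)
  have hφ : ContinuousOn φ {p : ℝ × ℝ | 1 ≤ p.1 ^ 2 + p.2 ^ 2} := by
    refine (c1.sub c2).add (Continuous.continuousOn (by fun_prop))
  obtain ⟨⟨a, b⟩, hpS, hmax⟩ := hScomp.exists_isMaxOn ⟨(x, y), hxy, hrR⟩
    (hφ.mono fun p hp => hp.1)
  have hge : d ≤ φ (a, b) := by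
    have h1 : φ (x, y) ≤ φ (a, b) := hmax ⟨hxy, hrR⟩
    have h2 : d ≤ φ (x, y) := by
      have : 0 ≤ δ * (x ^ 2 + y ^ 2) := by positivity
      simp only [φ]; linarith
    linarith
  have hφab : φ (a, b) = w₁ a b - w₂ a b + δ * (a ^ 2 + b ^ 2) := rfl
  obtain ⟨hp1, hp2⟩ := hpS
  simp only at hp1 hp2
  have hle : δ * (a ^ 2 + b ^ 2) ≤ d / 2 := by
    rw [← hδR]; gcongr
  rcases hp1.eq_or_lt with h1 | h1
  · have := hb a b h1.symm
    linarith
  rcases hp2.eq_or_lt with h2 | h2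
  · have e1 := (abs_le.1 (k1 a b hp1)).2
    have e2 := (abs_le.1 (k2 a b hp1)).1
    rw [h2, Real.sqrt_sq hRpos.le] at e1 e2
    have : K * R⁻¹ < d / 4 := by
      rw [← div_eq_mul_inv, div_lt_iff₀ hRpos]; linarith
    linarith
  have hopen : IsOpen {p : ℝ × ℝ | 1 < p.1 ^ 2 + p.2 ^ 2} :=
    isOpen_lt continuous_const (by fun_prop)
  have hopen2 : IsOpen {p : ℝ × ℝ | p.1 ^ 2 + p.2 ^ 2 < R ^ 2} :=
    isOpen_lt (by fun_prop) continuous_const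
  have hlm : IsLocalMax φ (a, b) := by
    filter_upwards [hopen.mem_nhds h1, hopen2.mem_nhds h2] with q hq1 hq2
    exact hmax ⟨le_of_lt hq1, le_of_lt hq2⟩
  have hcφ : ContinuousAt φ (a, b) :=
    hφ.continuousAt (mem_of_superset (hopen.mem_nhds (show (a, b) ∈ _ from h1)) fun p hp => by
      simp only [mem_ofPred_eq] at hp ⊢; exact hp.le)
  have D1 := d1.contDiffAt (x := (a, b)) (hopen.mem_nhds h1)
  have D2 := d2.contDiffAt (x := (a, b)) (hopen.mem_nhds h1)
  have sx : ContDiffAt ℝ 2 (fun t : ℝ => (t, b)) a := by fun_prop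
  have sy : ContDiffAt ℝ 2 (fun t : ℝ => (a, t)) b := by fun_prop
  have tx : Tendsto (fun t : ℝ => (t, b)) (𝓝 a) (𝓝 (a, b)) := sx.continuousAt
  have ty : Tendsto (fun t : ℝ => (a, t)) (𝓝 b) (𝓝 (a, b)) := sy.continuousAt
  have Ex := dd_comb (fun t => w₁ t b) (fun t => w₂ t b) δ (b ^ 2) a
    (ContDiffAt.comp (g := Function.uncurry w₁) a D1 sx) (ContDiffAt.comp (g := Function.uncurry w₂) a D2 sx)
  have Ey := dd_comb (fun t => w₁ a t) (fun t => w₂ a t) δ (a ^ 2) b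
    (ContDiffAt.comp (g := Function.uncurry w₁) b D1 sy) (ContDiffAt.comp (g := Function.uncurry w₂) b D2 sy)
  have L1 := l1 a b h1
  have L2 := l2 a b h1
  have ey : (fun t => w₁ a t - w₂ a t + δ * (t ^ 2 + a ^ 2)) = fun t => φ (a, t) := by
    funext t; simp only [φ]; ring
  rw [ey] at Ey
  rcases lt_or_ge 0 (deriv (deriv (fun t => φ (t, b))) a) with hp | hp
  · exact no_max_of_pos _ a (ContinuousAt.comp (f := fun t : ℝ => (t, b)) hcφ tx)
      (tx.eventually hlm) hp
  · refine no_max_of_pos (fun t => φ (a, t)) b (ContinuousAt.comp (f := fun t : ℝ => (a, t)) hcφ ty)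
      (ty.eventually hlm) ?_
    simp only [φ] at hp
    linarith

lemma slice_x (G : ℂ → ℂ) (x y : ℝ) (h : DifferentiableAt ℂ G (x + y * Complex.I)) :
    HasDerivAt (fun t : ℝ => (G (t + y * Complex.I)).re) (deriv G (x + y * Complex.I)).re x := by
  have h1 : HasDerivAt (fun z : ℂ => G (z + y * Complex.I)) (deriv G (x + y * Complex.I)) (x : ℂ) := by
    simpa using h.hasDerivAt.comp_add_const (x : ℂ) (y * Complex.I)
  exact h1.real_of_complex

lemma slice_y (G : ℂ → ℂ) (x y : ℝ) (h : DifferentiableAt ℂ G (x + y * Complex.I)) :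
    HasDerivAt (fun t : ℝ => (G (x + t * Complex.I)).re)
      (deriv G (x + y * Complex.I) * Complex.I).re y := by
  have h0 : HasDerivAt (fun z : ℂ => (x : ℂ) + z * Complex.I) Complex.I (y : ℂ) := by
    simpa using ((hasDerivAt_id (y : ℂ)).mul_const Complex.I).const_add (x : ℂ)
  have h1 : HasDerivAt (fun z : ℂ => G (x + z * Complex.I))
      (deriv G (x + y * Complex.I) * Complex.I) (y : ℂ) :=
    HasDerivAt.comp (y : ℂ) h.hasDerivAt h0
  exact h1.real_of_complex

lemma harm (F : ℂ → ℂ) (W : ℂ → ℝ) (U : Set ℂ) (hU : IsOpen U) (hF : DifferentiableOn ℂ F U)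
    (hW : ∀ z ∈ U, W z = (F z).re) (x y : ℝ) (hz : (x + y * Complex.I : ℂ) ∈ U) :
    deriv (deriv (fun t : ℝ => W (t + y * Complex.I))) x +
      deriv (deriv (fun t : ℝ => W (x + t * Complex.I))) y = 0 := by
  have cx : Continuous fun t : ℝ => (t + y * Complex.I : ℂ) := by fun_prop
  have cy : Continuous fun t : ℝ => (x + t * Complex.I : ℂ) := by fun_prop
  have hF' : DifferentiableOn ℂ (deriv F) U := hF.deriv hU
  have ox := hU.preimage cx
  have oy := hU.preimage cy
  have ex : deriv (fun t : ℝ => W (t + y * Complex.I)) =ᶠ[𝓝 x]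
      fun t : ℝ => (deriv F (t + y * Complex.I)).re := by
    filter_upwards [ox.mem_nhds hz] with t ht
    have e : (fun t : ℝ => W (t + y * Complex.I)) =ᶠ[𝓝 t] fun t : ℝ => (F (t + y * Complex.I)).re := by
      filter_upwards [ox.mem_nhds ht] with s hs using hW _ hs
    rw [e.deriv_eq]
    exact (slice_x F t y (hF.differentiableAt (hU.mem_nhds ht))).deriv
  have ey : deriv (fun t : ℝ => W (x + t * Complex.I)) =ᶠ[𝓝 y]
      fun t : ℝ => (deriv F (x + t * Complex.I) * Complex.I).re := by
    filter_upwards [oy.mem_nhds hz] with t ht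
    have e : (fun t : ℝ => W (x + t * Complex.I)) =ᶠ[𝓝 t] fun t : ℝ => (F (x + t * Complex.I)).re := by
      filter_upwards [oy.mem_nhds ht] with s hs using hW _ hs
    rw [e.deriv_eq]
    exact (slice_y F x t (hF.differentiableAt (hU.mem_nhds ht))).deriv
  have hd := hF'.differentiableAt (hU.mem_nhds hz)
  rw [ex.deriv_eq, ey.deriv_eq, (slice_x (deriv F) x y hd).deriv,
    (slice_y (fun z => deriv F z * Complex.I) x y (hd.mul_const _)).deriv, deriv_mul_const hd]
  simp

lemma contDiff_re (F : ℂ → ℂ) (W : ℂ → ℝ) (U : Set ℂ) (hU : IsOpen U) (hF : DifferentiableOn ℂ F U)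
    (hW : ∀ z ∈ U, W z = (F z).re) : ContDiffOn ℝ 2 W U := by
  have h1 : ContDiffOn ℝ 2 F U := (hF.contDiffOn hU).restrict_scalars ℝ
  have h2 : ContDiffOn ℝ 2 (fun z => (F z).re) U := Complex.reCLM.contDiff.comp_contDiffOn h1
  exact h2.congr hW

noncomputable def cE (t : ℝ) : ℂ := Complex.exp (t * Complex.I)

@[fun_prop]
lemma cE_cont : Continuous cE := by unfold cE; fun_prop

lemma cE_norm (t : ℝ) : ‖cE t‖ = 1 := Complex.norm_exp_ofReal_mul_I t

lemma cE_per : Function.Periodic cE (2 * Real.pi) := by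
  intro t
  unfold cE
  push_cast
  rw [add_mul, Complex.exp_add, Complex.exp_two_pi_mul_I, mul_one]

lemma cE_sub_le (z : ℂ) (t : ℝ) : ‖z‖ - 1 ≤ ‖z - cE t‖ := by
  have := norm_sub_norm_le z (cE t)
  rwa [cE_norm] at this

lemma cE_sub_ne {z : ℂ} (hz : 1 < ‖z‖) (t : ℝ) : z - cE t ≠ 0 := by
  rw [← norm_pos_iff]
  linarith [cE_sub_le z t]

noncomputable def cF (g : ℝ → ℝ) (z : ℂ) : ℂ :=
  ∫ t in (0 : ℝ)..(2 * Real.pi), (Real.pi : ℂ)⁻¹ * (g t * (cE t / (z - cE t)))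

lemma ker_cont {z : ℂ} (hz : 1 < ‖z‖) : Continuous fun t => cE t / (z - cE t) :=
  cE_cont.div (by fun_prop) (cE_sub_ne hz)

lemma cF_diff (g : ℝ → ℝ) (hg : Continuous g) : DifferentiableOn ℂ (cF g) {z | 1 < ‖z‖} := by
  intro z hz
  apply DifferentiableAt.differentiableWithinAt
  have hz : 1 < ‖z‖ := hz
  set ρ := (‖z‖ - 1) / 2 with hρ
  have hρ0 : 0 < ρ := by linarith
  have hball : ∀ w ∈ Metric.ball z ρ, 1 + ρ ≤ ‖w‖ := by
    intro w hw
    rw [Metric.mem_ball, dist_comm, dist_eq_norm] at hw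
    linarith [norm_sub_norm_le z w]
  have hc : ∀ w : ℂ, 1 < ‖w‖ →
      Continuous fun t => (Real.pi : ℂ)⁻¹ * (g t * (cE t / (w - cE t))) := by
    intro w hw
    have := ker_cont hw
    fun_prop
  have hopen : IsOpen {z : ℂ | 1 < ‖z‖} := isOpen_lt continuous_const continuous_norm
  have := intervalIntegral.hasDerivAt_integral_of_dominated_loc_of_deriv_le (𝕜 := ℂ) (μ := volume)
    (a := 0) (b := 2 * Real.pi)
    (F := fun w t => (Real.pi : ℂ)⁻¹ * (g t * (cE t / (w - cE t))))
    (F' := fun w t => (Real.pi : ℂ)⁻¹ * (g t * (- cE t / (w - cE t) ^ 2)))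
    (bound := fun t => Real.pi⁻¹ * (|g t| * (1 / ρ ^ 2)))
    (Metric.ball_mem_nhds z hρ0)
    (by filter_upwards [hopen.mem_nhds hz] with w hw using (hc w hw).aestronglyMeasurable)
    ((hc z hz).intervalIntegrable _ _)
    (by
      have : Continuous fun t => (- cE t / (z - cE t) ^ 2) :=
        cE_cont.neg.div (by fun_prop) fun t => pow_ne_zero 2 (cE_sub_ne hz t)
      exact Continuous.aestronglyMeasurable (by fun_prop))
    (by
      refine Eventually.of_forall fun t _ w hw => ?_
      have h1 := hball w hw
      have h2 := cE_sub_le w t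
      rw [norm_mul, norm_mul, norm_div, norm_neg, cE_norm, norm_pow, norm_inv, Complex.norm_real,
        Complex.norm_real, Real.norm_eq_abs, Real.norm_eq_abs, abs_of_pos Real.pi_pos]
      gcongr
      linarith)
    (Continuous.intervalIntegrable (by fun_prop) _ _)
    (by
      refine Eventually.of_forall fun t _ w hw => ?_
      have h1 := hball w hw
      have h2 := cE_sub_ne (z := w) (by linarith) t
      refine HasDerivAt.const_mul _ (HasDerivAt.const_mul _ ?_)
      have := (hasDerivAt_const w (cE t)).div ((hasDerivAt_id w).sub_const (cE t)) h2
      exact this.congr_deriv (by simp))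
  exact this.2.differentiableAt

noncomputable def cP (z : ℂ) (t : ℝ) : ℝ := (‖z‖ ^ 2 - 1) / ‖z - cE t‖ ^ 2

lemma cP_nonneg {z : ℂ} (hz : 1 < ‖z‖) (t : ℝ) : 0 ≤ cP z t := by
  unfold cP
  have : 0 ≤ ‖z‖ ^ 2 - 1 := by nlinarith
  positivity

lemma cP_cont {z : ℂ} (hz : 1 < ‖z‖) : Continuous (cP z) := by
  unfold cP
  exact continuous_const.div (by fun_prop) fun t => pow_ne_zero 2 (norm_ne_zero_iff.2 (cE_sub_ne hz t))

lemma cP_eq {z : ℂ} (hz : 1 < ‖z‖) (t : ℝ) : cP z t = 1 + 2 * (cE t / (z - cE t)).re := by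
  have h1 := cE_sub_ne hz t
  have h2 : Complex.normSq (z - cE t) ≠ 0 := by simpa using h1
  have h3 : Complex.normSq (cE t) = 1 := by rw [Complex.normSq_eq_norm_sq, cE_norm]; norm_num
  unfold cP
  rw [Complex.div_re, ← Complex.normSq_eq_norm_sq, ← Complex.normSq_eq_norm_sq]
  field_simp
  rw [Complex.normSq_apply] at h3
  simp only [Complex.normSq_apply, Complex.sub_re, Complex.sub_im]
  linear_combination h3

lemma ker_int {z : ℂ} (hz : 1 < ‖z‖) :
    ∫ t in (0 : ℝ)..(2 * Real.pi), cE t / (z - cE t) = 0 := by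
  have h : (∮ s in C(0, 1), (z - s)⁻¹) = 0 := by
    apply DiffContOnCl.circleIntegral_eq_zero zero_le_one
    apply DifferentiableOn.diffContOnCl_ball (U := Metric.closedBall 0 1) _ subset_rfl
    intro s hs
    have : z - s ≠ 0 := by
      rintro h
      rw [sub_eq_zero] at h
      subst h
      simp at hs
      linarith
    apply DifferentiableAt.differentiableWithinAt
    fun_prop (disch := assumption)
  rw [circleIntegral] at h
  have e : ∀ t : ℝ, deriv (circleMap 0 1) t • (z - circleMap 0 1 t)⁻¹ =
      Complex.I * (cE t / (z - cE t)) := by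
    intro t
    simp only [deriv_circleMap, circleMap, cE, smul_eq_mul]
    simp
    ring
  simp only [e, intervalIntegral.integral_const_mul] at h
  simpa using h

lemma cP_int {z : ℂ} (hz : 1 < ‖z‖) : ∫ t in (0 : ℝ)..(2 * Real.pi), cP z t = 2 * Real.pi := by
  have hc := ker_cont hz
  simp only [cP_eq hz]
  rw [intervalIntegral.integral_add (by simp) (Continuous.intervalIntegrable (by fun_prop) _ _),
    intervalIntegral.integral_const_mul]
  have : ∫ t in (0 : ℝ)..(2 * Real.pi), (cE t / (z - cE t)).re =
      (∫ t in (0 : ℝ)..(2 * Real.pi), (cE t / (z - cE t))).re :=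
    intervalIntegral.intervalIntegral_re (𝕜 := ℂ) (hc.intervalIntegrable _ _)
  rw [this, ker_int hz]
  simp

lemma cF_re (g : ℝ → ℝ) (hg : Continuous g) (h0 : (∫ θ in (0:ℝ)..(2 * Real.pi), g θ) = 0)
    {z : ℂ} (hz : 1 < ‖z‖) :
    (cF g z).re = ∫ t in (0 : ℝ)..(2 * Real.pi), (2 * Real.pi)⁻¹ * cP z t * g t := by
  have hc := ker_cont hz
  have hp := Real.pi_pos.ne'
  unfold cF
  have : ∫ t in (0 : ℝ)..(2 * Real.pi), ((Real.pi : ℂ)⁻¹ * (g t * (cE t / (z - cE t)))).re =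
      (∫ t in (0 : ℝ)..(2 * Real.pi), ((Real.pi : ℂ)⁻¹ * (g t * (cE t / (z - cE t))))).re :=
    intervalIntegral.intervalIntegral_re (𝕜 := ℂ)
      (f := fun t => (Real.pi : ℂ)⁻¹ * (g t * (cE t / (z - cE t))))
      (Continuous.intervalIntegrable (by fun_prop) _ _)
  rw [← this]
  have e : ∀ t, (2 * Real.pi)⁻¹ * cP z t * g t = (2 * Real.pi)⁻¹ * g t +
      ((Real.pi : ℂ)⁻¹ * (g t * (cE t / (z - cE t)))).re := by
    intro t
    rw [cP_eq hz, ← Complex.ofReal_inv, Complex.re_ofReal_mul, Complex.re_ofReal_mul]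
    field_simp
  simp only [e]
  rw [intervalIntegral.integral_add (Continuous.intervalIntegrable (by fun_prop) _ _)
    (Continuous.intervalIntegrable (by fun_prop) _ _), intervalIntegral.integral_const_mul, h0]
  simp

lemma cF_bound (g : ℝ → ℝ) (hg : Continuous g) (h0 : (∫ θ in (0:ℝ)..(2 * Real.pi), g θ) = 0)
    (M : ℝ) (hM : ∀ t, |g t| ≤ M) {z : ℂ} (hz : 1 < ‖z‖) :
    |(cF g z).re| ≤ 4 * ‖z‖⁻¹ * M := by
  have hM0 : 0 ≤ M := (abs_nonneg _).trans (hM 0)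
  have hpi := Real.pi_pos
  have hz0 : 0 < ‖z‖ := by linarith
  rcases le_total ‖z‖ 2 with h | h
  · have h1 : |(cF g z).re| ≤ M := by
      rw [cF_re g hg h0 hz]
      have hc := cP_cont hz
      have := intervalIntegral.norm_integral_le_of_norm_le (μ := volume) (a := 0)
        (b := 2 * Real.pi) (f := fun t => (2 * Real.pi)⁻¹ * cP z t * g t)
        (g := fun t => (2 * Real.pi)⁻¹ * cP z t * M) (by positivity)
        (Eventually.of_forall fun t _ => by
          have := cP_nonneg hz t
          rw [norm_mul, Real.norm_of_nonneg (by positivity)]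
          gcongr
          exact hM t)
        (Continuous.intervalIntegrable (by fun_prop) _ _)
      rw [intervalIntegral.integral_mul_const, intervalIntegral.integral_const_mul, cP_int hz,
        inv_mul_cancel₀ (by positivity), one_mul] at this
      exact this
    have h2 : 1 ≤ 4 * ‖z‖⁻¹ := by
      rw [← div_eq_mul_inv, le_div_iff₀ hz0]; linarith
    nlinarith
  · refine (Complex.abs_re_le_norm _).trans ?_
    have := intervalIntegral.norm_integral_le_of_norm_le_const (a := 0)
        (b := 2 * Real.pi) (f := fun t => (Real.pi : ℂ)⁻¹ * (g t * (cE t / (z - cE t))))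
        (C := Real.pi⁻¹ * (M * (2 / ‖z‖))) (by
          intro t _
          have h2 := cE_sub_le z t
          rw [norm_mul, norm_mul, norm_div, cE_norm, norm_inv, Complex.norm_real,
            Complex.norm_real, Real.norm_eq_abs, Real.norm_eq_abs, abs_of_pos Real.pi_pos]
          have h3 : 1 / ‖z - cE t‖ ≤ 2 / ‖z‖ := by
            rw [div_le_div_iff₀ (by linarith) hz0]; linarith
          have h4 := hM t
          gcongr)
    refine this.trans (le_of_eq ?_)
    rw [sub_zero, abs_of_pos (by positivity)]
    field_simp
    norm_num

lemma cE_inj {t θ : ℝ} (ht : t ∈ Icc (θ - Real.pi) (θ + Real.pi)) (h : cE t = cE θ) : t = θ := by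
  unfold cE at h
  rw [Complex.exp_eq_exp_iff_exists_int] at h
  obtain ⟨n, hn⟩ := h
  have h2 : t = θ + n * (2 * Real.pi) := by
    have := congrArg Complex.im hn
    simpa using this
  have hpi := Real.pi_pos
  have a1 : (n : ℝ) < 1 := by
    by_contra! hh
    nlinarith [ht.2]
  have a2 : (-1 : ℝ) < n := by
    by_contra! hh
    nlinarith [ht.1]
  have : n = 0 := by
    have b1 : n < 1 := by exact_mod_cast a1
    have b2 : -1 < n := by exact_mod_cast a2
    omega
  simp [h2, this]

lemma cF_lim (g : ℝ → ℝ) (hg : Continuous g) (hper : Function.Periodic g (2 * Real.pi))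
    (h0 : (∫ θ in (0:ℝ)..(2 * Real.pi), g θ) = 0) (θ : ℝ) :
    Tendsto (fun z => (cF g z).re) (𝓝[{z | 1 < ‖z‖}] (cE θ)) (𝓝 (g θ)) := by
  have hpi := Real.pi_pos
  have hev : ∀ᶠ z in 𝓝[{z | 1 < ‖z‖}] (cE θ), 1 < ‖z‖ := eventually_mem_nhdsWithin
  have hshift : ∀ f : ℝ → ℝ, Function.Periodic f (2 * Real.pi) →
      ∫ t in (0 : ℝ)..(2 * Real.pi), f t = ∫ t in Ioc (θ - Real.pi) (θ + Real.pi), f t := by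
    intro f hf
    have := hf.intervalIntegral_add_eq 0 (θ - Real.pi)
    rw [zero_add] at this
    rw [this, intervalIntegral.integral_of_le (by linarith)]
    congr 3
    ring
  have hPper : ∀ z, Function.Periodic (cP z) (2 * Real.pi) := by
    intro z t
    unfold cP
    rw [cE_per t]
  have main := tendsto_setIntegral_peak_smul_of_integrableOn_of_tendsto (μ := volume)
    (s := Ioc (θ - Real.pi) (θ + Real.pi)) (t := Ioc (θ - Real.pi) (θ + Real.pi))
    (l := 𝓝[{z | 1 < ‖z‖}] (cE θ)) (φ := fun z t => (2 * Real.pi)⁻¹ * cP z t) (g := g)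
    (x₀ := θ) (a := g θ) measurableSet_Ioc measurableSet_Ioc subset_rfl self_mem_nhdsWithin
    (by simp)
    (by
      filter_upwards [hev] with z hz t _
      have := cP_nonneg hz t
      positivity)
    (by
      intro u hu hθ
      have hK : IsCompact (Icc (θ - Real.pi) (θ + Real.pi) \ u) := isCompact_Icc.diff hu
      obtain ⟨c, hc0, hc⟩ := hK.exists_forall_le' (f := fun t => ‖cE θ - cE t‖) (a := 0)
        (Continuous.continuousOn (by fun_prop)) (by
          rintro t ⟨ht, htu⟩
          rw [norm_pos_iff, sub_ne_zero]
          intro h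
          rw [cE_inj ht h.symm] at htu
          exact htu hθ)
      rw [Metric.tendstoUniformlyOn_iff]
      intro ε hε
      have hlim : Tendsto (fun z : ℂ => (2 * Real.pi)⁻¹ * ((‖z‖ ^ 2 - 1) / (c / 2) ^ 2))
          (𝓝[{z | 1 < ‖z‖}] (cE θ)) (𝓝 0) := by
        have hcont : Continuous fun z : ℂ => (2 * Real.pi)⁻¹ * ((‖z‖ ^ 2 - 1) / (c / 2) ^ 2) := by
          fun_prop
        have := (hcont.tendsto (cE θ)).mono_left (nhdsWithin_le_nhds (s := {z | 1 < ‖z‖}))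
        simpa [cE_norm] using this
      filter_upwards [hev, hlim.eventually (gt_mem_nhds hε),
        nhdsWithin_le_nhds (Metric.ball_mem_nhds (cE θ) (half_pos hc0))] with z hz hz2 hz3 t ht
      have hct := hc t ⟨Ioc_subset_Icc_self ht.1, ht.2⟩
      rw [Metric.mem_ball, dist_comm, dist_eq_norm] at hz3
      have h1 : c / 2 ≤ ‖z - cE t‖ := by
        have := norm_add_le (cE θ - z) (z - cE t)
        rw [sub_add_sub_cancel] at this
        linarith
      have hP := cP_nonneg hz t
      rw [Pi.zero_apply, dist_zero_left, Real.norm_of_nonneg (by positivity)]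
      refine lt_of_le_of_lt ?_ hz2
      unfold cP
      have : 0 ≤ ‖z‖ ^ 2 - 1 := by nlinarith
      gcongr)
    (by
      refine tendsto_const_nhds.congr' ?_
      filter_upwards [hev] with z hz
      rw [integral_const_mul, ← hshift _ (hPper z), cP_int hz, inv_mul_cancel₀ (by positivity)])
    (by
      filter_upwards [hev] with z hz
      have := cP_cont hz
      exact Continuous.aestronglyMeasurable (by fun_prop))
    ((hg.integrableOn_Icc).mono_set Ioc_subset_Icc_self)
    (hg.continuousWithinAt)
  refine main.congr' ?_
  filter_upwards [hev] with z hz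
  rw [cF_re g hg h0 hz, hshift]
  · rfl
  · intro t
    show _ * cP z (t + 2 * Real.pi) * g (t + 2 * Real.pi) = _
    rw [hPper z t, hper t]

/-- Exterior Dirichlet problem on `ℝ² \ B₁`: boundary data with zero mean on the circle
admits a unique harmonic extension decaying like `C |x|⁻¹ sup |g|`. -/
theorem exterior_dirichlet_decay :
    ∃ C > 0, ∀ g : ℝ → ℝ, Continuous g → Function.Periodic g (2 * Real.pi) →
      (∫ θ in (0:ℝ)..(2 * Real.pi), g θ) = 0 →
      ∃ w : ℝ → ℝ → ℝ,
        (ContinuousOn (Function.uncurry w) {p : ℝ × ℝ | 1 ≤ p.1 ^ 2 + p.2 ^ 2} ∧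
          ContDiffOn ℝ 2 (Function.uncurry w) {p : ℝ × ℝ | 1 < p.1 ^ 2 + p.2 ^ 2} ∧
          (∀ x y : ℝ, 1 < x ^ 2 + y ^ 2 →
            deriv (deriv (fun x' => w x' y)) x + deriv (deriv (fun y' => w x y')) y = 0) ∧
          (∀ θ, w (Real.cos θ) (Real.sin θ) = g θ) ∧
          (∀ x y : ℝ, 1 ≤ x ^ 2 + y ^ 2 →
            |w x y| ≤ C * (Real.sqrt (x ^ 2 + y ^ 2))⁻¹ * (⨆ θ, |g θ|))) ∧
        (∀ w' : ℝ → ℝ → ℝ,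
          (ContinuousOn (Function.uncurry w') {p : ℝ × ℝ | 1 ≤ p.1 ^ 2 + p.2 ^ 2} ∧
            ContDiffOn ℝ 2 (Function.uncurry w') {p : ℝ × ℝ | 1 < p.1 ^ 2 + p.2 ^ 2} ∧
            (∀ x y : ℝ, 1 < x ^ 2 + y ^ 2 →
              deriv (deriv (fun x' => w' x' y)) x + deriv (deriv (fun y' => w' x y')) y = 0) ∧
            (∀ θ, w' (Real.cos θ) (Real.sin θ) = g θ) ∧
            (∀ x y : ℝ, 1 ≤ x ^ 2 + y ^ 2 →
              |w' x y| ≤ C * (Real.sqrt (x ^ 2 + y ^ 2))⁻¹ * (⨆ θ, |g θ|))) →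
          ∀ x y : ℝ, 1 ≤ x ^ 2 + y ^ 2 → w' x y = w x y) := by
  refine ⟨4, by norm_num, fun g hg hper h0 => ?_⟩
  have hbdd : BddAbove (range fun θ => |g θ|) := by
    obtain ⟨B, hB⟩ := isCompact_Icc.exists_bound_of_continuousOn (s := Icc 0 (2 * Real.pi))
      hg.continuousOn
    refine ⟨B, ?_⟩
    rintro _ ⟨θ, rfl⟩
    obtain ⟨s, hs, e⟩ := hper.exists_mem_Ico₀ (by positivity) θ
    simp only [e]
    exact hB s (Ico_subset_Icc_self hs)
  have hM : ∀ t, |g t| ≤ ⨆ θ, |g θ| := fun t => le_ciSup hbdd t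
  set M := ⨆ θ, |g θ| with hMdef
  let A : Set ℂ := {z | 1 < ‖z‖}
  have hA : IsOpen A := isOpen_lt continuous_const continuous_norm
  have hcl : {z : ℂ | 1 ≤ ‖z‖} ⊆ closure A := by
    intro z (hz : 1 ≤ ‖z‖)
    have hlim : Tendsto (fun r : ℝ => (r : ℂ) * z) (𝓝[>] 1) (𝓝 z) := by
      have : Continuous fun r : ℝ => (r : ℂ) * z := by fun_prop
      have := (this.tendsto 1).mono_left (nhdsWithin_le_nhds (s := Ioi 1))
      simpa using this
    refine mem_closure_of_tendsto hlim ?_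
    filter_upwards [self_mem_nhdsWithin] with r hr
    have hr : 1 < r := hr
    show 1 < ‖(r : ℂ) * z‖
    rw [norm_mul, Complex.norm_real, Real.norm_of_nonneg (by linarith)]
    nlinarith
  have hF := cF_diff g hg
  let W : ℂ → ℝ := extendFrom A fun z => (cF g z).re
  have hpolar : ∀ z : ℂ, ‖z‖ = 1 → z = cE z.arg := by
    intro z hz
    have := Complex.norm_mul_exp_arg_mul_I z
    rw [hz, Complex.ofReal_one, one_mul] at this
    exact this.symm
  have hin : ∀ z ∈ A, Tendsto (fun z => (cF g z).re) (𝓝[A] z) (𝓝 (cF g z).re) := by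
    intro z hz
    exact ((Complex.continuous_re.continuousAt).comp
      (hF.differentiableAt (hA.mem_nhds hz)).continuousAt).continuousWithinAt
  have hWA : ∀ z ∈ A, W z = (cF g z).re := fun z hz =>
    extendFrom_eq (subset_closure hz) (hin z hz)
  have hWb : ∀ θ, W (cE θ) = g θ := fun θ =>
    extendFrom_eq (hcl (cE_norm θ).ge) (cF_lim g hg hper h0 θ)
  have hWc : ContinuousOn W {z : ℂ | 1 ≤ ‖z‖} := by
    refine continuousOn_extendFrom hcl ?_
    intro z (hz : 1 ≤ ‖z‖)
    rcases hz.eq_or_lt with h | h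
    · rw [hpolar z h.symm]
      exact ⟨_, cF_lim g hg hper h0 _⟩
    · exact ⟨_, hin z h⟩
  have hnorm : ∀ x y : ℝ, ‖(x + y * Complex.I : ℂ)‖ = Real.sqrt (x ^ 2 + y ^ 2) :=
    Complex.norm_add_mul_I
  have hm1 : ∀ x y : ℝ, 1 ≤ x ^ 2 + y ^ 2 → 1 ≤ ‖(x + y * Complex.I : ℂ)‖ := by
    intro x y h; rw [hnorm]; exact Real.one_le_sqrt.2 h
  have hm2 : ∀ x y : ℝ, 1 < x ^ 2 + y ^ 2 → 1 < ‖(x + y * Complex.I : ℂ)‖ := by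
    intro x y h; rw [hnorm, Real.lt_sqrt (by norm_num)]; simpa using h
  let ι : ℝ × ℝ → ℂ := fun p => p.1 + p.2 * Complex.I
  have hι : ContDiff ℝ 2 ι := by
    have e : ι = fun p => Complex.ofRealCLM p.1 + Complex.ofRealCLM p.2 * Complex.I := rfl
    rw [e]
    fun_prop
  have hcs : ∀ θ : ℝ, ((Real.cos θ : ℝ) + (Real.sin θ : ℝ) * Complex.I : ℂ) = cE θ := by
    intro θ
    unfold cE
    rw [Complex.exp_mul_I]
    simp
  have hsol : ContinuousOn (Function.uncurry fun x y : ℝ => W (x + y * Complex.I))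
        {p : ℝ × ℝ | 1 ≤ p.1 ^ 2 + p.2 ^ 2} ∧
      ContDiffOn ℝ 2 (Function.uncurry fun x y : ℝ => W (x + y * Complex.I))
        {p : ℝ × ℝ | 1 < p.1 ^ 2 + p.2 ^ 2} ∧
      (∀ x y : ℝ, 1 < x ^ 2 + y ^ 2 →
        deriv (deriv (fun x' : ℝ => W (x' + y * Complex.I))) x +
          deriv (deriv (fun y' : ℝ => W (x + y' * Complex.I))) y = 0) ∧
      (∀ θ : ℝ, W ((Real.cos θ : ℝ) + (Real.sin θ : ℝ) * Complex.I) = g θ) ∧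
      (∀ x y : ℝ, 1 ≤ x ^ 2 + y ^ 2 →
        |W (x + y * Complex.I)| ≤ 4 * (Real.sqrt (x ^ 2 + y ^ 2))⁻¹ * M) := by
    refine ⟨?_, ?_, ?_, ?_, ?_⟩
    · exact hWc.comp (f := ι) hι.continuous.continuousOn fun p hp => hm1 p.1 p.2 hp
    · exact (contDiff_re (cF g) W A hA hF hWA).comp (f := ι) hι.contDiffOn
        fun p hp => hm2 p.1 p.2 hp
    · intro x y h
      exact harm (cF g) W A hA hF hWA x y (hm2 x y h)
    · intro θ
      rw [hcs, hWb]
    · intro x y h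
      rw [← hnorm]
      rcases (hm1 x y h).eq_or_lt with h | h
      · rw [← h, hpolar _ h.symm, hWb]
        have := hM (Complex.arg (x + y * Complex.I))
        have := abs_nonneg (g (Complex.arg (x + y * Complex.I)))
        simp only [inv_one]
        linarith
      · rw [hWA _ h]
        exact cF_bound g hg h0 M hM h
  refine ⟨fun x y => W (x + y * Complex.I), hsol, ?_⟩
  rintro w' ⟨c1, d1, l1, b1, k1⟩ x y hxy
  obtain ⟨c2, d2, l2, b2, k2⟩ := hsol
  have hb : ∀ x y : ℝ, x ^ 2 + y ^ 2 = 1 → w' x y = W (x + y * Complex.I) := by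
    intro x y h
    have h1 : ‖(x + y * Complex.I : ℂ)‖ = 1 := by rw [hnorm, h, Real.sqrt_one]
    have h2 := hpolar _ h1
    set θ := Complex.arg (x + y * Complex.I) with hθ
    rw [← hcs θ] at h2
    have hx : x = Real.cos θ := by
      simpa [-Complex.ofReal_cos, -Complex.ofReal_sin] using congrArg Complex.re h2
    have hy : y = Real.sin θ := by
      simpa [-Complex.ofReal_cos, -Complex.ofReal_sin] using congrArg Complex.im h2
    rw [h2, b2, ← b1, ← hx, ← hy]
  have k1' : ∀ x y : ℝ, 1 ≤ x ^ 2 + y ^ 2 → |w' x y| ≤ 4 * M * (Real.sqrt (x ^ 2 + y ^ 2))⁻¹ :=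
    fun x y h => (k1 x y h).trans_eq (by ring)
  have k2' : ∀ x y : ℝ, 1 ≤ x ^ 2 + y ^ 2 →
      |W (x + y * Complex.I)| ≤ 4 * M * (Real.sqrt (x ^ 2 + y ^ 2))⁻¹ :=
    fun x y h => (k2 x y h).trans_eq (by ring)
  exact le_antisymm
    (ext_cmp w' (fun x y => W (x + y * Complex.I)) (4 * M) c1 c2 d1 d2 l1 l2 hb k1' k2' x y hxy)
    (ext_cmp (fun x y => W (x + y * Complex.I)) w' (4 * M) c2 c1 d2 d1 l2 l1
      (fun x y h => (hb x y h).symm) k2' k1' x y hxy)
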